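/- Fix q ∈ (0,1), ν ∈ [0,1), R, L ≥ 0 and an integer m ≥ 1. Suppose f : ℤ^m → ℝ satisfies the two-body boundary conditions: for every n⃗ ∈ ℤ^m and every index 1 ≤ i ≤ m−1 with n_i = n_{i+1}, (ν(1−q)/(1−qν))·f(n⃗⁻_{i,i+1}) + ((q−ν)/(1−qν))·f(n⃗⁻_{i+1}) + ((1−q)/(1−qν))·f(n⃗) = f(n⃗⁻_i), where n⃗⁻_I denotes n⃗ with each coordinate indexed by I decreased by 1. Then for every n ∈ ℤ, with n⃗ = (n,…,n): (i) ∑_{i=1}^{m} R·((1−q)/(1−ν))·( f(n⃗⁻_i) − f(n⃗) ) = ∑_{j=1}^{m} φ^R_{q,ν}(j|m)·( f(n,…,n,n−1,…,n−1) − f(n⃗) ), where the argument has m−j entries equal to n followed by j entries equal to n−1; and (ii) ∑_{i=1}^{m} L·((1−q)/(1−ν))·( f(n⃗⁺_i) − f(n⃗) ) = ∑_{j=1}^{m} φ^L_{q,ν}(j|m)·( f(n+1,…,n+1,n,…,n) − f(n⃗) ), where the argument has j entries equal to n+1 followed by m−j entries equal to n, and n⃗⁺_i denotes n⃗ with the i-th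 coordinate increased by 1. -/

import Mathlib

/-- The finite `q`-Pochhammer symbol `(a;q)_n = ∏_{i=0}^{n−1}(1 − a q^i)`. -/
noncomputable def qPoch (a q : ℝ) (n : ℕ) : ℝ := ∏ i ∈ Finset.range n, (1 - a * q ^ i)

/-- Right jump rates `φ^R_{q,ν}(j|m)`. -/
noncomputable def phiR (q ν R : ℝ) (j m : ℕ) : ℝ :=
  R * ν ^ (j - 1) / ((1 - q ^ j) / (1 - q)) * (qPoch ν q (m - j) / qPoch ν q m) *
    (qPoch q q m / qPoch q q (m - j))

/-- Left jump rates `φ^L_{q,ν}(j|m)`. -/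
noncomputable def phiL (q ν L : ℝ) (j m : ℕ) : ℝ :=
  L / ((1 - q ^ j) / (1 - q)) * (qPoch ν q (m - j) / qPoch ν q m) *
    (qPoch q q m / qPoch q q (m - j))

/-- `n⃗` with the `i`-th coordinate decreased by 1. -/
def decOne {m : ℕ} (n : Fin m → ℤ) (i : Fin m) : Fin m → ℤ :=
  Function.update n i (n i - 1)

/-- `n⃗` with the `i`-th coordinate increased by 1. -/
def incOne {m : ℕ} (n : Fin m → ℤ) (i : Fin m) : Fin m → ℤ :=
  Function.update n i (n i + 1)

/-- `n⃗` with the coordinates `i` and `i'` each decreased by 1. -/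
def decTwo {m : ℕ} (n : Fin m → ℤ) (i i' : Fin m) : Fin m → ℤ :=
  fun t => if t = i ∨ t = i' then n t - 1 else n t


/-! ### Scalar identity -/

/-- ratio `(bs;q)_j/(as;q)_j` -/
noncomputable def rr (q a b s : ℝ) (j : ℕ) : ℝ :=
  ∏ l ∈ Finset.range j, (1 - b * s * q ^ l) / (1 - a * s * q ^ l)

/-- coefficients -/
noncomputable def cc (q a b : ℝ) (m j : ℕ) : ℝ :=
  a ^ j / (1 - q ^ (j + 1)) *
    ∏ i ∈ Finset.range (j + 1), (1 - q ^ (m - i)) / (b - a * q ^ (m - 1 - i))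

noncomputable def ee (q a b : ℝ) (m j : ℕ) : ℝ :=
  ∏ i ∈ Finset.range j, (1 - q ^ (m - i)) / (b - a * q ^ (m - 1 - i))

lemma ee_shift (q a b : ℝ) (m j : ℕ) :
    ee q a b (m + 1) (j + 1) = (1 - q ^ (m + 1)) / (b - a * q ^ m) * ee q a b m j := by
  unfold ee
  rw [Finset.prod_range_succ', mul_comm]
  congr 1
  apply Finset.prod_congr rfl
  intro i _
  have e1 : m + 1 - (i + 1) = m - i := by omega
  have e2 : m + 1 - 1 - (i + 1) = m - 1 - i := by omega
  rw [e1, e2]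

lemma cc_eq (q a b : ℝ) (m j : ℕ) :
    cc q a b m j = a ^ j / (1 - q ^ (j + 1)) * ee q a b m (j + 1) := rfl

lemma core_alg (q a b s E r v w u : ℝ) (h1 : 1 - q * v ≠ 0) (h2 : b - a * (q * v * w) ≠ 0)
    (h3 : b - a * w ≠ 0) (h4 : 1 - a * s * v ≠ 0) (h5 : 1 - a * s * (q * v * w) ≠ 0) :
    (q * v * w * (1 - b * s) - u * (q * w) * E * r * (1 - b * s * v)) /
        ((1 - a * s * (q * v * w)) * (b - a * (q * v * w))) +
      (u / (1 - q * v) * ((1 - q * q * v * w) / (b - a * (q * v * w)) * E)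
        - u / (1 - q * v) * (E * ((1 - q * w) / (b - a * w)))) *
        (r * ((1 - b * s * v) / (1 - a * s * v)))
    = (q * v * w * (1 - b * s) - a * u * w * (E * ((1 - q * w) / (b - a * w))) *
        (r * ((1 - b * s * v) / (1 - a * s * v))) * (1 - b * s * (q * v))) /
        ((1 - a * s * (q * v * w)) * (b - a * (q * v * w))) := by
  have k : (1 - q * q * v * w) / (b - a * (q * v * w)) - (1 - q * w) / (b - a * w)
      = w * (1 - q * v) * (b * q - a) / ((b - a * (q * v * w)) * (b - a * w)) := by
    rw [div_sub_div _ _ h2 h3]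
    congr 1
    ring
  have k2 : (u / (1 - q * v) * ((1 - q * q * v * w) / (b - a * (q * v * w)) * E)
        - u / (1 - q * v) * (E * ((1 - q * w) / (b - a * w))))
      = u * E * w * (b * q - a) / ((b - a * (q * v * w)) * (b - a * w)) := by
    have : (u / (1 - q * v) * ((1 - q * q * v * w) / (b - a * (q * v * w)) * E)
        - u / (1 - q * v) * (E * ((1 - q * w) / (b - a * w))))
      = u / (1 - q * v) * E * ((1 - q * q * v * w) / (b - a * (q * v * w)) -
        (1 - q * w) / (b - a * w)) := by ring
    rw [this, k, div_mul_eq_mul_div, div_mul_div_comm, div_eq_div_iff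
      (mul_ne_zero h1 (mul_ne_zero h2 h3)) (mul_ne_zero h2 h3)]
    ring
  rw [k2]
  generalize hA : b - a * (q * v * w) = A at *
  generalize hB : b - a * w = B at *
  generalize hC : 1 - a * s * v = G at *
  generalize hD : 1 - a * s * (q * v * w) = H at *
  field_simp
  subst hB hC hD
  ring

/-- telescoping partial sums -/
lemma partial_sum (q a b s : ℝ) (m : ℕ) (hq : ∀ k, 1 ≤ k → 1 - q ^ k ≠ 0)
    (hb : ∀ k, b - a * q ^ k ≠ 0) (hs : ∀ k, 1 - a * s * q ^ k ≠ 0) (J : ℕ) (hJ : J ≤ m) :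
    ∑ j ∈ Finset.range J, (cc q a b (m + 1) j - cc q a b m j) * rr q a b s (j + 1)
      = (q ^ m * (1 - b * s) - a ^ J * q ^ (m - J)
          * ee q a b m J * rr q a b s J * (1 - b * s * q ^ J)) /
        ((1 - a * s * q ^ m) * (b - a * q ^ m)) := by
  induction J with
  | zero => simp [ee, rr]
  | succ J ih =>
    rw [Finset.sum_range_succ, ih (by omega)]
    obtain ⟨M, rfl⟩ : ∃ M, m = J + 1 + M := ⟨m - (J + 1), by omega⟩
    have e1 : J + 1 + M - J = M + 1 := by omega
    have e2 : J + 1 + M - (J + 1) = M := by omega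
    have e4 : J + 1 + M - 1 - J = M := by omega
    have e3 : ee q a b (J + 1 + M) (J + 1)
        = ee q a b (J + 1 + M) J * ((1 - q ^ (M + 1)) / (b - a * q ^ M)) := by
      unfold ee
      rw [Finset.prod_range_succ, e1, e4]
    have e5 : rr q a b s (J + 1)
        = rr q a b s J * ((1 - b * s * q ^ J) / (1 - a * s * q ^ J)) := by
      unfold rr
      rw [Finset.prod_range_succ]
    rw [cc_eq, cc_eq, ee_shift, e3, e5, e1, e2]
    have h1 := hq (J + 1) (by omega)
    have h2 := hb (J + 1 + M)
    have h3 := hb M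
    have h4 := hs J
    have h5 := hs (J + 1 + M)
    generalize ee q a b (J + 1 + M) J = E
    generalize rr q a b s J = r
    have p1 : q ^ (J + 1 + M) = q * q ^ J * q ^ M := by ring
    have p2 : q ^ (J + 1 + M + 1) = q * q * q ^ J * q ^ M := by ring
    have p3 : q ^ (J + 1) = q * q ^ J := by ring
    have p4 : q ^ (M + 1) = q * q ^ M := by ring
    have p5 : a ^ (J + 1) = a * a ^ J := by ring
    rw [p1] at h2 h5
    rw [p3] at h1
    rw [p1, p2, p3, p4, p5]
    exact core_alg q a b s E r (q ^ J) (q ^ M) (a ^ J) h1 h2 h3 h4 h5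

lemma total_sum (q a b s : ℝ) (m : ℕ) (hq : ∀ k, 1 ≤ k → 1 - q ^ k ≠ 0)
    (hb : ∀ k, b - a * q ^ k ≠ 0) (hs : ∀ k, 1 - a * s * q ^ k ≠ 0) :
    ∑ j ∈ Finset.range m, (cc q a b (m + 1) j - cc q a b m j) * rr q a b s (j + 1)
      + cc q a b (m + 1) m * rr q a b s (m + 1)
      = q ^ m * (1 - b * s) / ((1 - a * s * q ^ m) * (b - a * q ^ m)) := by
  rw [partial_sum q a b s m hq hb hs m le_rfl, cc_eq, ee_shift]
  have e5 : rr q a b s (m + 1)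
      = rr q a b s m * ((1 - b * s * q ^ m) / (1 - a * s * q ^ m)) := by
    unfold rr
    rw [Finset.prod_range_succ]
  rw [e5]
  have h1 := hq (m + 1) (by omega)
  have h2 := hb m
  have h5 := hs m
  simp only [Nat.sub_self, pow_zero]
  field_simp
  ring

lemma rr_zero (q a b : ℝ) (j : ℕ) : rr q a b 0 j = 1 := by simp [rr]

lemma scalar_id (q a b s : ℝ) (hq : ∀ k, 1 ≤ k → 1 - q ^ k ≠ 0)
    (hb : ∀ k, b - a * q ^ k ≠ 0) (hs : ∀ k, 1 - a * s * q ^ k ≠ 0) (m : ℕ) :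
    ∑ j ∈ Finset.range m, cc q a b m j * (rr q a b s (j + 1) - 1)
      = ∑ l ∈ Finset.range m, (-(s * q ^ l)) / (1 - a * s * q ^ l) := by
  induction m with
  | zero => simp
  | succ m ih =>
    rw [Finset.sum_range_succ _ m, Finset.sum_range_succ _ m, ← ih]
    have t1 := total_sum q a b s m hq hb hs
    have t0 := total_sum q a b 0 m hq hb (by simp)
    simp only [rr_zero, mul_one] at t0
    have : ∑ j ∈ Finset.range m, cc q a b (m + 1) j * (rr q a b s (j + 1) - 1)
        = ∑ j ∈ Finset.range m, cc q a b m j * (rr q a b s (j + 1) - 1)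
        + (∑ j ∈ Finset.range m, (cc q a b (m + 1) j - cc q a b m j) * rr q a b s (j + 1)
          - ∑ j ∈ Finset.range m, (cc q a b (m + 1) j - cc q a b m j)) := by
      rw [← Finset.sum_sub_distrib, ← Finset.sum_add_distrib]
      apply Finset.sum_congr rfl
      intro j _
      ring
    rw [this]
    have h2 := hb m
    have h5 := hs m
    have key : q ^ m * (1 - b * s) / ((1 - a * s * q ^ m) * (b - a * q ^ m))
        - q ^ m * (1 - b * 0) / ((1 - a * 0 * q ^ m) * (b - a * q ^ m))
        = (-(s * q ^ m)) / (1 - a * s * q ^ m) := by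
      simp only [mul_zero, zero_mul, sub_zero, one_mul]
      rw [div_sub_div _ _ (mul_ne_zero h5 h2) h2, div_eq_div_iff
        (mul_ne_zero (mul_ne_zero h5 h2) h2) h5]
      ring
    rw [← key, ← t1, ← t0]
    ring

/-! ### Representation of words by polynomials -/

open Polynomial in
/-- the map sending `x^j` to `Z^m U^j`, where `U = Z⁻¹ D` -/
noncomputable def Lam {A : Type*} [Ring A] [Algebra ℝ A] (q : ℝ) (Z D : A) (m : ℕ)
    (P : ℝ[X]) : A :=
  ∑ j ∈ Finset.range (m + 1), (P.coeff j * (∏ i ∈ Finset.range j, (q ^ i)⁻¹)) •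
    (Z ^ (m - j) * D ^ j)

lemma D_Zpow {A : Type*} [Ring A] [Algebra ℝ A] (q : ℝ) (Z D : A) (h : D * Z = q • (Z * D))
    (k : ℕ) : D * Z ^ k = q ^ k • (Z ^ k * D) := by
  induction k with
  | zero => simp
  | succ k ih =>
    rw [pow_succ, ← mul_assoc, ih, smul_mul_assoc, mul_assoc, h, mul_smul_comm, smul_smul,
      ← mul_assoc, ← pow_succ, ← pow_succ]

open Polynomial in
lemma Lam_step {A : Type*} [Ring A] [Algebra ℝ A] (q : ℝ) (hq : q ≠ 0) (Z D : A)
    (h : D * Z = q • (Z * D)) (m : ℕ) (P : ℝ[X]) (hP : P.natDegree ≤ m) (c a : ℝ) :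
    Lam q Z D (m + 1) (P * (C c + C (a * q ^ m) * X)) = (c • Z + a • D) * Lam q Z D m P := by
  unfold Lam
  have hc : ∀ j, (P * (C c + C (a * q ^ m) * X)).coeff j
      = P.coeff j * c + (if j = 0 then 0 else P.coeff (j - 1) * (a * q ^ m)) := by
    intro j
    rw [mul_add, coeff_add, coeff_mul_C, ← mul_assoc]
    congr 1
    cases j with
    | zero => simp
    | succ j => rw [coeff_mul_X, coeff_mul_C]; simp
  simp only [hc, add_mul, add_smul, Finset.sum_add_distrib]
  congr 1
  · rw [Finset.sum_range_succ, coeff_eq_zero_of_natDegree_lt (by omega : P.natDegree < m + 1),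
      Finset.mul_sum]
    simp only [zero_mul, zero_smul, add_zero]
    apply Finset.sum_congr rfl
    intro j hj
    have : m + 1 - j = (m - j) + 1 := by have := Finset.mem_range.1 hj; omega
    rw [this, smul_mul_smul_comm, pow_succ', mul_assoc Z]
    congr 1
    ring
  · rw [Finset.sum_range_succ', Finset.mul_sum]
    simp only [if_true, zero_mul, zero_smul, add_zero]
    apply Finset.sum_congr rfl
    intro j hj
    have hj' := Finset.mem_range.1 hj
    have : m + 1 - (j + 1) = m - j := by omega
    rw [this, smul_mul_smul_comm, ← mul_assoc D, D_Zpow q Z D h, smul_mul_assoc, smul_smul,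
      mul_assoc (Z ^ (m - j)), ← pow_succ']
    congr 1
    rw [if_neg (by omega), Finset.prod_range_succ]
    have hm : q ^ m = q ^ (m - j) * q ^ j := by rw [← pow_add]; congr 1; omega
    rw [hm]
    simp only [Nat.add_sub_cancel]
    field_simp

open Polynomial in
/-- `w` is represented by `P` in degree `m` -/
def WRep {A : Type*} [Ring A] [Algebra ℝ A] (q : ℝ) (Z D : A) (m : ℕ) (P : ℝ[X]) (w : A) : Prop :=
  P.natDegree ≤ m ∧ Lam q Z D m P = w

open Polynomial in
lemma WRep_one {A : Type*} [Ring A] [Algebra ℝ A] (q : ℝ) (Z D : A) : WRep q Z D 0 1 1 := by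
  constructor <;> simp [Lam]

open Polynomial in
lemma WRep_step {A : Type*} [Ring A] [Algebra ℝ A] {q : ℝ} (hq : q ≠ 0) {Z D : A}
    (h : D * Z = q • (Z * D)) {m : ℕ} {P : ℝ[X]} {w : A} (hP : WRep q Z D m P w) (c a : ℝ) :
    WRep q Z D (m + 1) (P * (C c + C (a * q ^ m) * X)) ((c • Z + a • D) * w) := by
  obtain ⟨h1, h2⟩ := hP
  refine ⟨?_, by rw [Lam_step q hq Z D h m P h1, h2]⟩
  refine natDegree_mul_le.trans (add_le_add h1 ?_)
  compute_degree

open Polynomial in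
lemma WRep_pow {A : Type*} [Ring A] [Algebra ℝ A] {q : ℝ} (hq : q ≠ 0) {Z D : A}
    (h : D * Z = q • (Z * D)) {m : ℕ} {P : ℝ[X]} {w : A} (hP : WRep q Z D m P w) (c a : ℝ) (k : ℕ) :
    WRep q Z D (m + k) (P * ∏ l ∈ Finset.range k, (C c + C (a * q ^ (m + l)) * X))
      ((c • Z + a • D) ^ k * w) := by
  induction k with
  | zero => simpa using hP
  | succ k ih =>
    rw [Finset.prod_range_succ, ← mul_assoc P, pow_succ', mul_assoc (c • Z + a • D), ← add_assoc]
    exact WRep_step hq h ih c a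

open Polynomial in
lemma WRep_sum {A : Type*} [Ring A] [Algebra ℝ A] {q : ℝ} {Z D : A} {m : ℕ} {ι : Type*}
    (s : Finset ι) (co : ι → ℝ) (P : ι → ℝ[X]) (w : ι → A)
    (h : ∀ i ∈ s, WRep q Z D m (P i) (w i)) :
    Lam q Z D m (∑ i ∈ s, C (co i) * P i) = ∑ i ∈ s, co i • w i := by
  have e : ∑ i ∈ s, co i • w i = ∑ i ∈ s, co i • Lam q Z D m (P i) :=
    Finset.sum_congr rfl (fun i hi => by rw [(h i hi).2])
  rw [e]
  unfold Lam
  simp only [finsetSum_coeff, coeff_C_mul, Finset.smul_sum, Finset.sum_mul, Finset.sum_smul]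
  rw [Finset.sum_comm]
  refine Finset.sum_congr rfl fun i _ => Finset.sum_congr rfl fun j _ => ?_
  rw [smul_smul, mul_assoc]

open Polynomial in
lemma WRep_sub {A : Type*} [Ring A] [Algebra ℝ A] {q : ℝ} {Z D : A} {m : ℕ} {P Q : ℝ[X]} {w v : A}
    (h : WRep q Z D m P w) (h' : WRep q Z D m Q v) : WRep q Z D m (P - Q) (w - v) := by
  refine ⟨(natDegree_sub_le _ _).trans (max_le h.1 h'.1), ?_⟩
  rw [← h.2, ← h'.2]
  unfold Lam
  rw [← Finset.sum_sub_distrib]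
  refine Finset.sum_congr rfl fun i _ => ?_
  rw [coeff_sub, sub_mul, sub_smul]

open Polynomial in
lemma poly_eq_of_pos {P Q : ℝ[X]} (h : ∀ x : ℝ, 0 < x → P.eval x = Q.eval x) : P = Q :=
  eq_of_infinite_eval_eq P Q ((Set.Ioi_infinite (0 : ℝ)).mono fun x hx => h x hx)


/-! ### Algebra identities -/

lemma qPoch_ratio (a q : ℝ) (m j : ℕ) (hj : j ≤ m) :
    qPoch a q m = qPoch a q (m - j) * ∏ i ∈ Finset.range j, (1 - a * q ^ (m - 1 - i)) := by
  unfold qPoch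
  obtain ⟨k, rfl⟩ : ∃ k, m = k + j := ⟨m - j, by omega⟩
  rw [Nat.add_sub_cancel, Finset.prod_range_add]
  congr 1
  rw [← Finset.prod_range_reflect]
  refine Finset.prod_congr rfl fun i hi => ?_
  have := Finset.mem_range.1 hi
  rw [show k + (j - 1 - i) = k + j - 1 - i by omega]

lemma ee_qPoch (q ν : ℝ) (m j : ℕ) (hj : j ≤ m) (hν : qPoch ν q (m - j) ≠ 0)
    (hqq : qPoch q q (m - j) ≠ 0) :
    (qPoch ν q (m - j) / qPoch ν q m) * (qPoch q q m / qPoch q q (m - j)) = ee q ν 1 m j := by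
  rw [qPoch_ratio ν q m j hj, qPoch_ratio q q m j hj]
  unfold ee
  rw [Finset.prod_div_distrib]
  have : ∏ i ∈ Finset.range j, (1 - q ^ (m - i))
      = ∏ i ∈ Finset.range j, (1 - q * q ^ (m - 1 - i)) := by
    refine Finset.prod_congr rfl fun i hi => ?_
    have := Finset.mem_range.1 hi
    rw [← pow_succ', show m - 1 - i + 1 = m - i by omega]
  rw [this]
  field_simp

lemma qPoch_ne (a q : ℝ) (hq : q ∈ Set.Ioo (0 : ℝ) 1) (ha : a ∈ Set.Ico (0 : ℝ) 1) (k : ℕ) :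
    qPoch a q k ≠ 0 := by
  unfold qPoch
  refine Finset.prod_ne_zero_iff.2 fun i _ => ?_
  have h1 : q ^ i ≤ 1 := pow_le_one₀ hq.1.le hq.2.le
  have h0 : 0 ≤ q ^ i := pow_nonneg hq.1.le _
  have := mul_le_mul_of_nonneg_left h1 ha.1
  have := ha.2
  linarith

lemma phiR_eq (q ν R : ℝ) (hq : q ∈ Set.Ioo (0 : ℝ) 1) (hν : ν ∈ Set.Ico (0 : ℝ) 1) (m j : ℕ)
    (hj : j + 1 ≤ m) : phiR q ν R (j + 1) m = R * (1 - q) * cc q ν 1 m j := by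
  unfold phiR
  rw [mul_assoc, ee_qPoch q ν m (j + 1) hj (qPoch_ne ν q hq hν _)
    (qPoch_ne q q hq ⟨hq.1.le, hq.2⟩ _), cc_eq, Nat.add_sub_cancel, div_div_eq_mul_div]
  ring

lemma phiL_eq (q ν L : ℝ) (hq : q ∈ Set.Ioo (0 : ℝ) 1) (hν : ν ∈ Set.Ico (0 : ℝ) 1) (m j : ℕ)
    (hj : j + 1 ≤ m) : phiL q ν L (j + 1) m = -(L * (1 - q) * cc q⁻¹ 1 ν m j) := by
  unfold phiL
  rw [mul_assoc, ee_qPoch q ν m (j + 1) hj (qPoch_ne ν q hq hν _)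
    (qPoch_ne q q hq ⟨hq.1.le, hq.2⟩ _), cc_eq, div_div_eq_mul_div]
  have hq0 : q ≠ 0 := hq.1.ne'
  have e : ee q⁻¹ 1 ν m (j + 1) = (q⁻¹) ^ (j + 1) * ee q ν 1 m (j + 1) := by
    unfold ee
    have hc : (q⁻¹) ^ (j + 1) = ∏ i ∈ Finset.range (j + 1), q⁻¹ := by simp
    rw [hc, ← Finset.prod_mul_distrib]
    refine Finset.prod_congr rfl fun i hi => ?_
    have := Finset.mem_range.1 hi
    obtain ⟨k, rfl⟩ : ∃ k, m = k + 1 + i := ⟨m - 1 - i, by omega⟩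
    rw [show k + 1 + i - i = k + 1 by omega, show k + 1 + i - 1 - i = k by omega]
    have hk : q ^ k ≠ 0 := pow_ne_zero _ hq0
    have h1 : q ^ k ≤ 1 := pow_le_one₀ hq.1.le hq.2.le
    have h0 : 0 ≤ q ^ k := pow_nonneg hq.1.le _
    have h3 : 1 - ν * q ^ k ≠ 0 := by
      have := mul_le_mul_of_nonneg_left h1 hν.1
      have := hν.2
      linarith
    have e1 : 1 - q⁻¹ ^ (k + 1) = -((1 - q ^ (k + 1)) / q ^ (k + 1)) := by
      rw [inv_pow]; field_simp; ring
    have e2 : ν - 1 * q⁻¹ ^ k = -((1 - ν * q ^ k) / q ^ k) := by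
      rw [inv_pow]; field_simp; ring
    rw [e1, e2, neg_div_neg_eq, pow_succ]
    field_simp
  rw [e]
  have hj1 : q ^ (j + 1) < 1 := pow_lt_one₀ hq.1.le hq.2 (by omega)
  have hj0 : q ^ (j + 1) ≠ 0 := pow_ne_zero _ hq0
  have h4 : 1 - q ^ (j + 1) ≠ 0 := by linarith
  have e1 : 1 - q⁻¹ ^ (j + 1) = -((1 - q ^ (j + 1)) / q ^ (j + 1)) := by
    rw [inv_pow]; field_simp; ring
  rw [e1, inv_pow]
  field_simp
  simp

lemma rel_DZ {A : Type*} [Ring A] [Algebra ℝ A] (q ν : ℝ) (hqν : 1 - q * ν ≠ 0) (X Y : A)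
    (hrel : X * Y = (ν * (1 - q) / (1 - q * ν)) • (X * X) + ((q - ν) / (1 - q * ν)) • (Y * X)
      + ((1 - q) / (1 - q * ν)) • (Y * Y)) :
    (X - Y) * (Y - ν • X) = q • ((Y - ν • X) * (X - Y)) := by
  have h : (1 - q * ν) • (X * Y) = (ν * (1 - q)) • (X * X) + (q - ν) • (Y * X)
      + (1 - q) • (Y * Y) := by
    rw [hrel, smul_add, smul_add, smul_smul, smul_smul, smul_smul, mul_div_cancel₀ _ hqν,
      mul_div_cancel₀ _ hqν, mul_div_cancel₀ _ hqν]
  simp only [sub_mul, mul_sub, smul_mul_assoc, mul_smul_comm]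
  rw [← sub_eq_zero] at h ⊢
  rw [← h]
  module

section
open Polynomial

/-- polynomial of a letter -/
noncomputable def lpoly (q c a : ℝ) (l : ℕ) : ℝ[X] := C c + C (a * q ^ l) * X

lemma eval_lpoly (q c a x : ℝ) (l : ℕ) : (lpoly q c a l).eval x = c + a * q ^ l * x := by
  simp [lpoly]

lemma rep_one_defect {A : Type*} [Ring A] [Algebra ℝ A] {q : ℝ} (hq : q ≠ 0) {Z D : A}
    (h : D * Z = q • (Z * D)) (c a a' : ℝ) (m i : ℕ) (hi : i < m) :
    WRep q Z D m ((∏ l ∈ Finset.range (m - 1 - i), lpoly q c a l) * lpoly q c a' (m - 1 - i) *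
        ∏ l ∈ Finset.range i, lpoly q c a (m - 1 - i + 1 + l))
      ((c • Z + a • D) ^ i * ((c • Z + a' • D) * (c • Z + a • D) ^ (m - 1 - i))) := by
  obtain ⟨k, rfl⟩ : ∃ k, m = k + 1 + i := ⟨m - 1 - i, by omega⟩
  rw [show k + 1 + i - 1 - i = k by omega]
  have := WRep_pow hq h (WRep_step hq h (WRep_pow hq h (WRep_one q Z D) c a k) c a') c a i
  simpa [lpoly] using this

lemma rep_sorted {A : Type*} [Ring A] [Algebra ℝ A] {q : ℝ} (hq : q ≠ 0) {Z D : A}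
    (h : D * Z = q • (Z * D)) (c a a' : ℝ) (k j : ℕ) :
    WRep q Z D (j + k) ((∏ l ∈ Finset.range j, lpoly q c a l) *
        ∏ l ∈ Finset.range k, lpoly q c a' (j + l))
      ((c • Z + a' • D) ^ k * (c • Z + a • D) ^ j) := by
  have := WRep_pow hq h (WRep_pow hq h (WRep_one q Z D) c a j) c a' k
  simpa [lpoly] using this

lemma rep_const {A : Type*} [Ring A] [Algebra ℝ A] {q : ℝ} (hq : q ≠ 0) {Z D : A}
    (h : D * Z = q • (Z * D)) (c a : ℝ) (j : ℕ) :
    WRep q Z D j (∏ l ∈ Finset.range j, lpoly q c a l) ((c • Z + a • D) ^ j) := by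
  simpa using rep_sorted hq h c a 0 0 j

lemma one_defect_prod (F G : ℕ → ℝ) (m i : ℕ) (hi : i < m) (hF : ∀ l, F l ≠ 0) :
    (∏ l ∈ Finset.range (m - 1 - i), F l) * G (m - 1 - i) *
        ∏ l ∈ Finset.range i, F (m - 1 - i + 1 + l)
      = (∏ l ∈ Finset.range m, F l) * (G (m - 1 - i) / F (m - 1 - i)) := by
  obtain ⟨k, rfl⟩ : ∃ k, m = k + 1 + i := ⟨m - 1 - i, by omega⟩
  rw [show k + 1 + i - 1 - i = k by omega, Finset.prod_range_add, Finset.prod_range_succ]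
  have := hF k
  field_simp

set_option maxHeartbeats 2000000 in
theorem alg_right {A : Type*} [Ring A] [Algebra ℝ A] (q ν R : ℝ) (hq : q ∈ Set.Ioo (0 : ℝ) 1)
    (hν : ν ∈ Set.Ico (0 : ℝ) 1) (X Y : A)
    (hrel : X * Y = (ν * (1 - q) / (1 - q * ν)) • (X * X) + ((q - ν) / (1 - q * ν)) • (Y * X)
      + ((1 - q) / (1 - q * ν)) • (Y * Y)) (m : ℕ) :
    ∑ i ∈ Finset.range m, (R * ((1 - q) / (1 - ν))) • (Y ^ i * (X * Y ^ (m - 1 - i)) - Y ^ m)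
      = ∑ j ∈ Finset.range m, phiR q ν R (j + 1) m • (Y ^ (m - (j + 1)) * X ^ (j + 1) - Y ^ m) := by
  obtain ⟨hq0, hq1⟩ := id hq
  obtain ⟨hν0, hν1⟩ := id hν
  have hν' : 1 - ν ≠ 0 := by linarith
  have hqν : 1 - q * ν ≠ 0 := by nlinarith
  have hDZ := rel_DZ q ν hqν X Y hrel
  set D := X - Y with hD
  set Z := Y - ν • X with hZ
  have hX : X = (1 - ν)⁻¹ • Z + (1 - ν)⁻¹ • D := by
    rw [← smul_add, hD, hZ, eq_inv_smul_iff₀ hν']; module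
  have hY : Y = (1 - ν)⁻¹ • Z + ((1 - ν)⁻¹ * ν) • D := by
    rw [mul_smul, ← smul_add, hD, hZ, eq_inv_smul_iff₀ hν']; module
  clear_value D Z
  set c := (1 - ν)⁻¹ with hc
  have hcpos : 0 < c := inv_pos.2 (by linarith)
  have hl := WRep_sum (q := q) (Z := Z) (D := D) (m := m) (Finset.range m)
    (fun _ => R * ((1 - q) / (1 - ν))) _ (fun i => Y ^ i * (X * Y ^ (m - 1 - i)) - Y ^ m)
    (fun i hi => by
      have := WRep_sub (rep_one_defect hq0.ne' hDZ c (c * ν) c m i (Finset.mem_range.1 hi))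
        (rep_const hq0.ne' hDZ c (c * ν) m)
      rw [← hX, ← hY] at this
      exact this)
  have hr := WRep_sum (q := q) (Z := Z) (D := D) (m := m) (Finset.range m)
    (fun j => phiR q ν R (j + 1) m) (fun j => (∏ l ∈ Finset.range (j + 1), lpoly q c c l) *
        (∏ l ∈ Finset.range (m - (j + 1)), lpoly q c (c * ν) (j + 1 + l)) -
        ∏ l ∈ Finset.range m, lpoly q c (c * ν) l)
    (fun j => Y ^ (m - (j + 1)) * X ^ (j + 1) - Y ^ m)
    (fun j hj => by
      have h1 := rep_sorted hq0.ne' hDZ c c (c * ν) (m - (j + 1)) (j + 1)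
      rw [show j + 1 + (m - (j + 1)) = m by have := Finset.mem_range.1 hj; omega] at h1
      have := WRep_sub h1 (rep_const hq0.ne' hDZ c (c * ν) m)
      rw [← hX, ← hY] at this
      exact this)
  rw [← hl, ← hr]
  congr 1
  apply poly_eq_of_pos
  intro x hx
  simp only [eval_finsetSum, eval_mul, eval_sub, eval_C, eval_prod, eval_lpoly]
  have hqk : ∀ k, 0 < q ^ k := fun k => pow_pos hq0 k
  have hF : ∀ l, c + c * ν * q ^ l * x ≠ 0 := fun l => by
    have : 0 ≤ c * ν * q ^ l * x := by have := hqk l; positivity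
    linarith
  have hF' : ∀ l, 1 + ν * q ^ l * x ≠ 0 := fun l => by
    have : 0 ≤ ν * q ^ l * x := by have := hqk l; positivity
    linarith
  have key := scalar_id q ν 1 (-x)
    (fun k hk => by have := pow_lt_one₀ hq0.le hq1 (n := k) (by omega); linarith)
    (fun k => by
      have h1 : q ^ k ≤ 1 := pow_le_one₀ hq0.le hq1.le
      have := mul_le_mul_of_nonneg_left h1 hν0
      linarith)
    (fun k => by have := hF' k; intro h; apply this; linarith) m
  have L1 : ∀ i ∈ Finset.range m, _ := fun i hi => by
    have h := one_defect_prod (fun l => c + c * ν * q ^ l * x) (fun l => c + c * q ^ l * x) m i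
      (Finset.mem_range.1 hi) hF
    exact congrArg (fun t => R * ((1 - q) / (1 - ν)) *
      (t - ∏ l ∈ Finset.range m, (c + c * ν * q ^ l * x))) h
  rw [Finset.sum_congr rfl L1]
  set PY := ∏ l ∈ Finset.range m, (c + c * ν * q ^ l * x) with hPY
  rw [Finset.sum_range_reflect (fun k => R * ((1 - q) / (1 - ν)) *
    (PY * ((c + c * q ^ k * x) / (c + c * ν * q ^ k * x)) - PY))]
  have R1 : ∀ j ∈ Finset.range m, phiR q ν R (j + 1) m *
      ((∏ l ∈ Finset.range (j + 1), (c + c * q ^ l * x)) *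
        (∏ l ∈ Finset.range (m - (j + 1)), (c + c * ν * q ^ (j + 1 + l) * x)) - PY)
      = R * (1 - q) * PY * (cc q ν 1 m j * (rr q ν 1 (-x) (j + 1) - 1)) := by
    intro j hj
    have hj' := Finset.mem_range.1 hj
    rw [phiR_eq q ν R hq hν m j (by omega)]
    have : (∏ l ∈ Finset.range (j + 1), (c + c * q ^ l * x)) *
        (∏ l ∈ Finset.range (m - (j + 1)), (c + c * ν * q ^ (j + 1 + l) * x))
        = PY * rr q ν 1 (-x) (j + 1) := by
      have hs : PY = (∏ l ∈ Finset.range (j + 1), (c + c * ν * q ^ l * x)) *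
          ∏ l ∈ Finset.range (m - (j + 1)), (c + c * ν * q ^ (j + 1 + l) * x) := by
        rw [hPY, ← Finset.prod_range_add (fun l => c + c * ν * q ^ l * x)]
        congr 2
        omega
      rw [hs, mul_right_comm]
      congr 1
      unfold rr
      rw [← Finset.prod_mul_distrib]
      refine Finset.prod_congr rfl fun l _ => ?_
      have h1 : (1 - ν * -x * q ^ l) = 1 + ν * q ^ l * x := by ring
      have h2 := hF' l
      rw [h1]
      field_simp
      ring
    rw [this]
    ring
  have key2 := congrArg (fun t => R * (1 - q) * PY * t) key
  simp only [Finset.mul_sum] at key2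
  rw [Finset.sum_congr rfl R1, key2]
  refine Finset.sum_congr rfl fun l _ => ?_
  have h1 : (1 - ν * -x * q ^ l) = 1 + ν * q ^ l * x := by ring
  have h2 := hF' l
  have h3 : (c + c * q ^ l * x) / (c + c * ν * q ^ l * x) = (1 + q ^ l * x) / (1 + ν * q ^ l * x) := by
    rw [← mul_div_mul_left _ (1 + ν * q ^ l * x) hcpos.ne']
    congr 1 <;> ring
  rw [h1, h3]
  field_simp
  ring

set_option maxHeartbeats 2000000 in
theorem alg_left {A : Type*} [Ring A] [Algebra ℝ A] (q ν R : ℝ) (hq : q ∈ Set.Ioo (0 : ℝ) 1)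
    (hν : ν ∈ Set.Ico (0 : ℝ) 1) (X Y : A)
    (hrel : X * Y = (ν * (1 - q) / (1 - q * ν)) • (X * X) + ((q - ν) / (1 - q * ν)) • (Y * X)
      + ((1 - q) / (1 - q * ν)) • (Y * Y)) (m : ℕ) :
    ∑ i ∈ Finset.range m, (R * ((1 - q) / (1 - ν))) • (X ^ i * (Y * X ^ (m - 1 - i)) - X ^ m)
      = ∑ j ∈ Finset.range m, phiL q ν R (j + 1) m • (Y ^ (j + 1) * X ^ (m - (j + 1)) - X ^ m) := by
  obtain ⟨hq0, hq1⟩ := id hq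
  obtain ⟨hν0, hν1⟩ := id hν
  have hν' : 1 - ν ≠ 0 := by linarith
  have hqν : 1 - q * ν ≠ 0 := by nlinarith
  have hDZ := rel_DZ q ν hqν X Y hrel
  set D := X - Y with hD
  set Z := Y - ν • X with hZ
  have hX : X = (1 - ν)⁻¹ • Z + (1 - ν)⁻¹ • D := by
    rw [← smul_add, hD, hZ, eq_inv_smul_iff₀ hν']; module
  have hY : Y = (1 - ν)⁻¹ • Z + ((1 - ν)⁻¹ * ν) • D := by
    rw [mul_smul, ← smul_add, hD, hZ, eq_inv_smul_iff₀ hν']; module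
  clear_value D Z
  set c := (1 - ν)⁻¹ with hc
  have hcpos : 0 < c := inv_pos.2 (by linarith)
  have hl := WRep_sum (q := q) (Z := Z) (D := D) (m := m) (Finset.range m)
    (fun _ => R * ((1 - q) / (1 - ν))) _ (fun i => X ^ i * (Y * X ^ (m - 1 - i)) - X ^ m)
    (fun i hi => by
      have := WRep_sub (rep_one_defect hq0.ne' hDZ c c (c * ν) m i (Finset.mem_range.1 hi))
        (rep_const hq0.ne' hDZ c c m)
      rw [← hX, ← hY] at this
      exact this)
  have hr := WRep_sum (q := q) (Z := Z) (D := D) (m := m) (Finset.range m)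
    (fun j => phiL q ν R (j + 1) m)
    (fun j => (∏ l ∈ Finset.range (m - (j + 1)), lpoly q c c l) *
        (∏ l ∈ Finset.range (j + 1), lpoly q c (c * ν) (m - (j + 1) + l)) -
        ∏ l ∈ Finset.range m, lpoly q c c l)
    (fun j => Y ^ (j + 1) * X ^ (m - (j + 1)) - X ^ m)
    (fun j hj => by
      have h1 := rep_sorted hq0.ne' hDZ c c (c * ν) (j + 1) (m - (j + 1))
      rw [show (m - (j + 1)) + (j + 1) = m by have := Finset.mem_range.1 hj; omega] at h1
      have := WRep_sub h1 (rep_const hq0.ne' hDZ c c m)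
      rw [← hX, ← hY] at this
      exact this)
  rw [← hl, ← hr]
  congr 1
  apply poly_eq_of_pos
  intro x hx
  simp only [eval_finsetSum, eval_mul, eval_sub, eval_C, eval_prod, eval_lpoly]
  have hqk : ∀ k, 0 < q ^ k := fun k => pow_pos hq0 k
  have hF : ∀ l, c + c * q ^ l * x ≠ 0 := fun l => by have := hqk l; positivity
  have hF' : ∀ l, 1 + q ^ l * x ≠ 0 := fun l => by have := hqk l; positivity
  have hinv : ∀ k, 1 ≤ k → 1 < q⁻¹ ^ k := fun k hk =>
    one_lt_pow₀ ((one_lt_inv₀ hq0).2 hq1) (by omega)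
  have hsub : ∀ l, l < m → q ^ (m - 1) * q⁻¹ ^ l = q ^ (m - 1 - l) := fun l hlm => by
    rw [inv_pow, show m - 1 = (m - 1 - l) + l by omega, pow_add]
    have := (hqk l).ne'
    field_simp
    congr 1
    omega
  have key := scalar_id q⁻¹ 1 ν (-(x * q ^ (m - 1)))
    (fun k hk => by have := hinv k hk; linarith)
    (fun k => by
      rcases Nat.eq_zero_or_pos k with rfl | hk
      · simp; linarith
      · have := hinv k hk; linarith)
    (fun k => by
      have : 0 < x * q ^ (m - 1) * q⁻¹ ^ k := by positivity
      have : 0 < 1 + x * q ^ (m - 1) * q⁻¹ ^ k := by linarith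
      linarith) m
  have L1 : ∀ i ∈ Finset.range m, _ := fun i hi => by
    have h := one_defect_prod (fun l => c + c * q ^ l * x) (fun l => c + c * ν * q ^ l * x) m i
      (Finset.mem_range.1 hi) hF
    exact congrArg (fun t => R * ((1 - q) / (1 - ν)) *
      (t - ∏ l ∈ Finset.range m, (c + c * q ^ l * x))) h
  rw [Finset.sum_congr rfl L1]
  set PX := ∏ l ∈ Finset.range m, (c + c * q ^ l * x) with hPX
  have R1 : ∀ j ∈ Finset.range m, phiL q ν R (j + 1) m *
      ((∏ l ∈ Finset.range (m - (j + 1)), (c + c * q ^ l * x)) *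
        (∏ l ∈ Finset.range (j + 1), (c + c * ν * q ^ (m - (j + 1) + l) * x)) - PX)
      = -(R * (1 - q) * PX) *
        (cc q⁻¹ 1 ν m j * (rr q⁻¹ 1 ν (-(x * q ^ (m - 1))) (j + 1) - 1)) := by
    intro j hj
    have hj' := Finset.mem_range.1 hj
    rw [phiL_eq q ν R hq hν m j (by omega)]
    have : (∏ l ∈ Finset.range (m - (j + 1)), (c + c * q ^ l * x)) *
        (∏ l ∈ Finset.range (j + 1), (c + c * ν * q ^ (m - (j + 1) + l) * x))
        = PX * rr q⁻¹ 1 ν (-(x * q ^ (m - 1))) (j + 1) := by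
      have hs : PX = (∏ l ∈ Finset.range (m - (j + 1)), (c + c * q ^ l * x)) *
          ∏ l ∈ Finset.range (j + 1), (c + c * q ^ (m - (j + 1) + l) * x) := by
        rw [hPX, ← Finset.prod_range_add (fun l => c + c * q ^ l * x)]
        congr 2
        omega
      rw [hs, mul_assoc]
      congr 1
      rw [← Finset.prod_range_reflect, ← Finset.prod_range_reflect
        (fun l => c + c * q ^ (m - (j + 1) + l) * x)]
      unfold rr
      rw [← Finset.prod_mul_distrib]
      refine Finset.prod_congr rfl fun l hl => ?_
      have hl' := Finset.mem_range.1 hl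
      have h0 := hsub l (by omega)
      rw [show m - (j + 1) + (j + 1 - 1 - l) = m - 1 - l by omega]
      have h1 : (1 - 1 * -(x * q ^ (m - 1)) * q⁻¹ ^ l) = 1 + q ^ (m - 1 - l) * x := by
        rw [← h0]; ring
      have h1' : (1 - ν * -(x * q ^ (m - 1)) * q⁻¹ ^ l) = 1 + ν * q ^ (m - 1 - l) * x := by
        rw [← h0]; ring
      have h2 := hF' (m - 1 - l)
      rw [h1, h1']
      field_simp
    rw [this]
    ring
  have key2 := congrArg (fun t => -(R * (1 - q) * PX) * t) key
  simp only [Finset.mul_sum] at key2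
  rw [Finset.sum_congr rfl R1, key2]
  refine Finset.sum_congr rfl fun l hl => ?_
  have h0 := hsub l (Finset.mem_range.1 hl)
  have h1 : (1 - 1 * -(x * q ^ (m - 1)) * q⁻¹ ^ l) = 1 + q ^ (m - 1 - l) * x := by
    rw [← h0]; ring
  have h1' : -(-(x * q ^ (m - 1)) * q⁻¹ ^ l) = q ^ (m - 1 - l) * x := by
    rw [← h0]; ring
  have h2 := hF' (m - 1 - l)
  have h3 : (c + c * ν * q ^ (m - 1 - l) * x) / (c + c * q ^ (m - 1 - l) * x)
      = (1 + ν * q ^ (m - 1 - l) * x) / (1 + q ^ (m - 1 - l) * x) := by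
    rw [← mul_div_mul_left _ (1 + q ^ (m - 1 - l) * x) hcpos.ne']
    congr 1 <;> ring
  rw [h1, h1', h3]
  field_simp
  ring

end


/-! ### Bridge: words as operators -/

/-- functions on words satisfying the two-body relation -/
def wordK (α β γ : ℝ) : Submodule ℝ (List Bool → ℝ) where
  carrier := {g | ∀ u v : List Bool, g (u ++ true :: false :: v) =
    α * g (u ++ true :: true :: v) + β * g (u ++ false :: true :: v)
      + γ * g (u ++ false :: false :: v)}
  add_mem' := by
    intro a b ha hb u v
    simp only [Pi.add_apply]
    rw [ha u v, hb u v]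
    ring
  zero_mem' := by
    intro u v
    simp
  smul_mem' := by
    intro c a ha u v
    simp only [Pi.smul_apply, smul_eq_mul]
    rw [ha u v]
    ring

/-- appending a letter -/
def letterOp (α β γ : ℝ) (b : Bool) : Module.End ℝ (wordK α β γ) where
  toFun g := ⟨fun w => g.1 (w ++ [b]), by
    intro u v
    have := g.2 u (v ++ [b])
    simpa using this⟩
  map_add' := by intro x y; rfl
  map_smul' := by intro x y; rfl

lemma letterOp_apply (α β γ : ℝ) (b : Bool) (g : wordK α β γ) (w : List Bool) :
    (letterOp α β γ b g).1 w = g.1 (w ++ [b]) := rfl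

lemma letterOp_pow (α β γ : ℝ) (b : Bool) (k : ℕ) (g : wordK α β γ) (w : List Bool) :
    (((letterOp α β γ b) ^ k) g).1 w = g.1 (w ++ List.replicate k b) := by
  induction k generalizing w with
  | zero => simp
  | succ k ih =>
    rw [pow_succ', Module.End.mul_apply, letterOp_apply, ih, List.replicate_succ]
    simp

lemma letterOp_rel (α β γ : ℝ) :
    letterOp α β γ true * letterOp α β γ false
      = α • (letterOp α β γ true * letterOp α β γ true)
        + β • (letterOp α β γ false * letterOp α β γ true)
        + γ • (letterOp α β γ false * letterOp α β γ false) := by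
  apply LinearMap.ext
  intro g
  apply Subtype.ext
  funext w
  have := g.2 w []
  change g.1 ((w ++ [true]) ++ [false]) = α * g.1 ((w ++ [true]) ++ [true])
    + β * g.1 ((w ++ [false]) ++ [true]) + γ * g.1 ((w ++ [false]) ++ [false])
  simpa using this

/-- evaluation of an operator at `g` and the empty word -/
def evalAt (α β γ : ℝ) (g : wordK α β γ) : Module.End ℝ (wordK α β γ) →ₗ[ℝ] ℝ where
  toFun T := (T g).1 []
  map_add' := by intro x y; rfl
  map_smul' := by intro x y; rfl

lemma evalAt_pow (α β γ : ℝ) (g : wordK α β γ) (b : Bool) (k : ℕ) :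
    evalAt α β γ g (letterOp α β γ b ^ k) = g.1 (List.replicate k b) := by
  change (((letterOp α β γ b) ^ k) g).1 [] = _
  rw [letterOp_pow]
  simp

lemma evalAt_pow_pow (α β γ : ℝ) (g : wordK α β γ) (b b' : Bool) (k k' : ℕ) :
    evalAt α β γ g (letterOp α β γ b ^ k * letterOp α β γ b' ^ k')
      = g.1 (List.replicate k b ++ List.replicate k' b') := by
  change (((letterOp α β γ b) ^ k) (((letterOp α β γ b') ^ k') g)).1 [] = _
  rw [letterOp_pow, letterOp_pow]
  simp

lemma evalAt_defect (α β γ : ℝ) (g : wordK α β γ) (b b' : Bool) (k k' : ℕ) :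
    evalAt α β γ g (letterOp α β γ b ^ k * (letterOp α β γ b' * letterOp α β γ b ^ k'))
      = g.1 (List.replicate k b ++ b' :: List.replicate k' b) := by
  change (((letterOp α β γ b) ^ k) (letterOp α β γ b' (((letterOp α β γ b) ^ k') g))).1 [] = _
  rw [letterOp_pow, letterOp_apply, letterOp_pow]
  simp

/-- configuration of a word -/
def conf (m : ℕ) (n : ℤ) (w : List Bool) : Fin m → ℤ :=
  fun t => if w.getD t false then n - 1 else n

/-- function on words -/
noncomputable def wordFun (m : ℕ) (f : (Fin m → ℤ) → ℝ) (n : ℤ) (w : List Bool) : ℝ :=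
  if w.length = m then f (conf m n w) else 0

lemma getD_mid (u v : List Bool) (a b : Bool) (t : ℕ) :
    (u ++ a :: b :: v).getD t false = if t < u.length then u.getD t false
      else if t = u.length then a else if t = u.length + 1 then b
      else v.getD (t - u.length - 2) false := by
  simp only [List.getD_eq_getElem?_getD, List.getElem?_append]
  split_ifs with h1 h2 h3
  · rfl
  · subst h2; simp
  · subst h3; simp
  · obtain ⟨k, hk⟩ : ∃ k, t - u.length = k + 2 := ⟨t - u.length - 2, by omega⟩
    rw [hk]; simp

lemma wordFun_mem (α β γ : ℝ) (m : ℕ) (f : (Fin m → ℤ) → ℝ)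
    (hbc : ∀ (n : Fin m → ℤ) (i i' : Fin m), (i : ℕ) + 1 = (i' : ℕ) → n i = n i' →
      α * f (decTwo n i i') + β * f (decOne n i') + γ * f n = f (decOne n i)) (n : ℤ) :
    wordFun m f n ∈ wordK α β γ := by
  intro u v
  unfold wordFun
  simp only [List.length_append, List.length_cons]
  split_ifs with h
  · have key := hbc (conf m n (u ++ false :: false :: v)) ⟨u.length, by omega⟩
      ⟨u.length + 1, by omega⟩ rfl (by simp [conf, getD_mid])
    have e1 : decTwo (conf m n (u ++ false :: false :: v)) ⟨u.length, by omega⟩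
        ⟨u.length + 1, by omega⟩ = conf m n (u ++ true :: true :: v) := by
      funext t
      simp only [decTwo, conf, getD_mid, Fin.ext_iff]
      grind
    have e2 : decOne (conf m n (u ++ false :: false :: v)) 
        ⟨u.length + 1, by omega⟩ = conf m n (u ++ false :: true :: v) := by
      funext t
      simp only [decOne, conf, getD_mid, Function.update_apply, Fin.ext_iff]
      grind
    have e3 : decOne (conf m n (u ++ false :: false :: v)) 
        ⟨u.length, by omega⟩ = conf m n (u ++ true :: false :: v) := by
      funext t
      simp only [decOne, conf, getD_mid, Function.update_apply, Fin.ext_iff]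
      grind
    rw [e1, e2, e3] at key
    exact key.symm
  · simp

lemma getD_defect (k k' t : ℕ) (b b' : Bool) (ht : t < k + 1 + k') :
    (List.replicate k b ++ b' :: List.replicate k' b).getD t false = if t = k then b' else b := by
  simp only [List.getD_eq_getElem?_getD, List.getElem?_append, List.length_replicate]
  split_ifs with h1 h2 h2
  · omega
  · simp [h1]
  · subst h2; simp
  · obtain ⟨l, hl⟩ : ∃ l, t - k = l + 1 := ⟨t - k - 1, by omega⟩
    have : l < k' := by omega
    rw [hl]; simp [this]

lemma getD_two (k k' t : ℕ) (b b' : Bool) (ht : t < k + k') :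
    (List.replicate k b ++ List.replicate k' b').getD t false = if t < k then b else b' := by
  simp only [List.getD_eq_getElem?_getD, List.getElem?_append, List.length_replicate]
  split_ifs with h1
  · simp [h1]
  · have : t - k < k' := by omega
    simp [this]

lemma getD_one (k t : ℕ) (b : Bool) (ht : t < k) :
    (List.replicate k b).getD t false = b := by
  simp [List.getD_eq_getElem?_getD, ht]

/-- if `f : ℤ^m → ℝ` satisfies the two-body boundary conditions, then on any
constant vector `(n,…,n)` the free `m`-body operators coincide with the `q`-Hahn jump-rate
operators, both for right jumps (i) and left jumps (ii). -/
theorem boundary_condition_implies_m_body (q ν R L : ℝ) (hq : q ∈ Set.Ioo (0 : ℝ) 1)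
    (hν : ν ∈ Set.Ico (0 : ℝ) 1) (hR : 0 ≤ R) (hL : 0 ≤ L) (m : ℕ) (hm : 1 ≤ m)
    (f : (Fin m → ℤ) → ℝ)
    (hbc : ∀ (n : Fin m → ℤ) (i i' : Fin m), (i : ℕ) + 1 = (i' : ℕ) → n i = n i' →
      (ν * (1 - q) / (1 - q * ν)) * f (decTwo n i i')
        + ((q - ν) / (1 - q * ν)) * f (decOne n i')
        + ((1 - q) / (1 - q * ν)) * f n
        = f (decOne n i)) :
    ∀ n : ℤ,
      (∑ i : Fin m, R * ((1 - q) / (1 - ν)) * (f (decOne (fun _ => n) i) - f (fun _ => n))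
        = ∑ j ∈ Finset.Icc 1 m, phiR q ν R j m *
            (f (fun t => if (t : ℕ) < m - j then n else n - 1) - f (fun _ => n))) ∧
      (∑ i : Fin m, L * ((1 - q) / (1 - ν)) * (f (incOne (fun _ => n) i) - f (fun _ => n))
        = ∑ j ∈ Finset.Icc 1 m, phiL q ν L j m *
            (f (fun t => if (t : ℕ) < j then n + 1 else n) - f (fun _ => n))) := by
  intro n
  have sumIcc : ∀ h : ℕ → ℝ, ∑ j ∈ Finset.Icc 1 m, h j = ∑ j ∈ Finset.range m, h (j + 1) := by
    intro h
    rw [Finset.sum_bij (fun j _ => j - 1)]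
    · intro j hj; simp at hj ⊢; omega
    · intro a ha b hb; simp at ha hb ⊢; omega
    · intro b hb; exact ⟨b + 1, by simp at hb ⊢; omega, by simp⟩
    · intro j hj
      simp at hj
      congr 1; omega
  set α := ν * (1 - q) / (1 - q * ν) with hα
  set β := (q - ν) / (1 - q * ν) with hβ
  set γ := (1 - q) / (1 - q * ν) with hγ
  have rel := letterOp_rel α β γ
  have hmem := fun n => wordFun_mem α β γ m f hbc n
  constructor
  · have h := congrArg (evalAt α β γ ⟨_, hmem n⟩) (alg_right q ν R hq hν _ _ rel m)
    simp only [map_sum, map_smul, map_sub, evalAt_pow, evalAt_pow_pow, evalAt_defect,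
      smul_eq_mul] at h
    have w0 : wordFun m f n (List.replicate m false) = f (fun _ => n) := by
      simp only [wordFun, List.length_replicate, if_true]
      congr 1
      funext t
      simp [conf, getD_one _ _ _ t.2]
    rw [sumIcc]
    rw [← Fin.sum_univ_eq_sum_range
      (fun i => R * ((1 - q) / (1 - ν)) * (wordFun m f n (List.replicate i false ++
        true :: List.replicate (m - 1 - i) false) - wordFun m f n (List.replicate m false)))] at h
    convert h using 1
    · refine Finset.sum_congr rfl fun i _ => ?_
      have hi := i.2
      rw [w0]
      congr 2
      rw [wordFun, if_pos (by simp; omega)]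
      congr 1
      funext t
      have ht := t.2
      simp only [conf, decOne, Function.update_apply, Fin.ext_iff]
      rw [getD_defect _ _ _ _ _ (by omega)]
      split_ifs <;> simp_all
    · refine Finset.sum_congr rfl fun j hj => ?_
      have hj := Finset.mem_range.1 hj
      rw [w0]
      congr 2
      rw [wordFun, if_pos (by simp; omega)]
      congr 1
      funext t
      have ht := t.2
      simp only [conf]
      rw [getD_two _ _ _ _ _ (by omega)]
      split_ifs <;> simp_all
  · have h := congrArg (evalAt α β γ ⟨_, hmem (n + 1)⟩) (alg_left q ν L hq hν _ _ rel m)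
    simp only [map_sum, map_smul, map_sub, evalAt_pow, evalAt_pow_pow, evalAt_defect,
      smul_eq_mul] at h
    have w0 : wordFun m f (n + 1) (List.replicate m true) = f (fun _ => n) := by
      simp only [wordFun, List.length_replicate, if_true]
      congr 1
      funext t
      simp [conf, getD_one _ _ _ t.2]
    rw [sumIcc]
    rw [← Fin.sum_univ_eq_sum_range
      (fun i => L * ((1 - q) / (1 - ν)) * (wordFun m f (n + 1) (List.replicate i true ++
        false :: List.replicate (m - 1 - i) true) - wordFun m f (n + 1) (List.replicate m true)))]
      at h
    convert h using 1
    · refine Finset.sum_congr rfl fun i _ => ?_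
      have hi := i.2
      rw [w0]
      congr 2
      rw [wordFun, if_pos (by simp; omega)]
      congr 1
      funext t
      have ht := t.2
      simp only [conf, incOne, Function.update_apply, Fin.ext_iff]
      rw [getD_defect _ _ _ _ _ (by omega)]
      split_ifs <;> simp_all
    · refine Finset.sum_congr rfl fun j hj => ?_
      have hj := Finset.mem_range.1 hj
      rw [w0]
      congr 2
      rw [wordFun, if_pos (by simp; omega)]
      congr 1
      funext t
      have ht := t.2
      simp only [conf]
      rw [getD_two _ _ _ _ _ (by omega)]
      split_ifs <;> simp_all
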